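/- Let h : A* → B* be a homomorphism of free monoids and ω a strongly almost periodic sequence over A. If the image h(ω) = h(ω(0))h(ω(1))h(ω(2))… is an infinite sequence, then h(ω) is strongly almost periodic. -/

import Mathlib

/-- The segment of a sequence `ω` of length `l` starting at position `i`,
i.e. the string `ω(i)ω(i+1)…ω(i+l-1)`. -/
def seg {A : Type*} (ω : ℕ → A) (i l : ℕ) : List A :=
  List.ofFn (fun k : Fin l => ω (i + k))

/-- The string `x` occurs in the sequence `ω` starting at position `i`. -/
def OccursAt {A : Type*} (ω : ℕ → A) (x : List A) (i : ℕ) : Prop :=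
  seg ω i x.length = x

/-- A sequence is strongly almost periodic if every string occurring in it
occurs in every segment of some fixed length `l`. -/
def StronglyAP {A : Type*} (ω : ℕ → A) : Prop :=
  ∀ x : List A, (∃ i, OccursAt ω x i) →
    ∃ l, ∀ i, ∃ j, i ≤ j ∧ j + x.length ≤ i + l ∧ OccursAt ω x j

/-- The total length of the strings `v 0, …, v (n-1)`, i.e. the position in the
concatenation `v₀v₁v₂…` where `v n` starts. -/
def concatPos {B : Type*} (v : ℕ → List B) (n : ℕ) : ℕ :=
  ∑ m ∈ Finset.range n, (v m).length

/-- The concatenation `v₀v₁v₂…` is infinite. -/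
def ConcatInfinite {B : Type*} (v : ℕ → List B) : Prop :=
  ∀ N, ∃ n, N < concatPos v n

/-- The sequence `β` is the concatenation `v₀v₁v₂…` of the finite strings `v n`. -/
def IsConcatOf {B : Type*} (β : ℕ → B) (v : ℕ → List B) : Prop :=
  ∀ n k, ∀ hk : k < (v n).length, β (concatPos v n + k) = (v n)[k]'hk

theorem occursAt_iff {A : Type*} (ω : ℕ → A) (x : List A) (i : ℕ) :
    OccursAt ω x i ↔ ∀ k, ∀ hk : k < x.length, ω (i + k) = x[k] := by
  unfold OccursAt seg
  constructor
  · intro H k hk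
    have := List.getElem_of_eq H (i := k) (by simpa using hk)
    simpa using this
  · intro H
    apply List.ext_getElem
    · simp
    · intro k h₁ h₂
      simpa using H k h₂

theorem occursAt_seg_iff {A : Type*} (ω : ℕ → A) (i l j : ℕ) :
    OccursAt ω (seg ω i l) j ↔ ∀ k < l, ω (j + k) = ω (i + k) := by
  simp [occursAt_iff, seg]

theorem concatPos_zero {B : Type*} (v : ℕ → List B) : concatPos v 0 = 0 := by
  simp [concatPos]

theorem concatPos_succ {B : Type*} (v : ℕ → List B) (n : ℕ) :
    concatPos v (n + 1) = concatPos v n + (v n).length :=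
  Finset.sum_range_succ _ _

theorem concatPos_mono {B : Type*} (v : ℕ → List B) : Monotone (concatPos v) :=
  monotone_nat_of_le_succ fun n => by rw [concatPos_succ]; omega

/-- Every position before the start of `v n` lies inside some earlier string. -/
theorem exists_eq_concatPos_add {B : Type*} (v : ℕ → List B) {n t : ℕ}
    (ht : t < concatPos v n) :
    ∃ m < n, ∃ k < (v m).length, t = concatPos v m + k := by
  induction n with
  | zero => simp [concatPos_zero] at ht
  | succ n ih =>
    by_cases hlt : t < concatPos v n
    · obtain ⟨m, hm, H⟩ := ih hlt
      exact ⟨m, by omega, H⟩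
    · rw [concatPos_succ] at ht
      exact ⟨n, by omega, t - concatPos v n, by omega, by omega⟩

/-- If `v j, …, v (j+n-1)` agree with `v 0, …, v (n-1)`, their relative positions agree. -/
theorem concatPos_add_of_eq {B : Type*} (v : ℕ → List B) {j n : ℕ}
    (hv : ∀ k < n, v (j + k) = v k) {k : ℕ} (hk : k ≤ n) :
    concatPos v (j + k) = concatPos v j + concatPos v k := by
  induction k with
  | zero => simp [concatPos_zero]
  | succ k ih =>
    rw [← add_assoc, concatPos_succ, concatPos_succ, ih (by omega), hv k (by omega), add_assoc]

theorem IsConcatOf.eq_of_initial_eq {B : Type*} {β : ℕ → B} {v : ℕ → List B}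
    (hβ : IsConcatOf β v) {j n : ℕ} (hv : ∀ k < n, v (j + k) = v k) {t : ℕ}
    (ht : t < concatPos v n) : β (concatPos v j + t) = β t := by
  obtain ⟨m, hm, k, hk, rfl⟩ := exists_eq_concatPos_add v ht
  rw [← add_assoc, ← concatPos_add_of_eq v hv hm.le,
    hβ (j + m) k (by rw [hv m hm]; exact hk), hβ m k hk]
  exact List.getElem_of_eq (hv m hm) _

theorem concatPos_add_le {B : Type*} {v : ℕ → List B} {K : ℕ}
    (hK : ∀ n, (v n).length ≤ K) (a l : ℕ) :
    concatPos v (a + l) ≤ concatPos v a + K * l := by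
  induction l with
  | zero => simp
  | succ l ih =>
    rw [← add_assoc, concatPos_succ, Nat.mul_succ]
    have := hK (a + l)
    omega

/-- Every position is at distance at most `K` from the next start of a string, if all
strings have length at most `K`. -/
theorem ConcatInfinite.exists_concatPos_near {B : Type*} {v : ℕ → List B}
    (hinf : ConcatInfinite v) {K : ℕ} (hK : ∀ n, (v n).length ≤ K) (p : ℕ) :
    ∃ a, p ≤ concatPos v a ∧ concatPos v a ≤ p + K := by
  classical
  have hex : ∃ a, p ≤ concatPos v a := (hinf p).imp fun _ => le_of_lt
  refine ⟨Nat.find hex, Nat.find_spec hex, ?_⟩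
  rcases hfind : Nat.find hex with _ | a
  · simp [concatPos_zero]
  · have hlt := Nat.find_min hex (m := a) (by omega)
    have := hK a
    rw [concatPos_succ]
    omega

theorem StronglyAP.concat {A B : Type*} [Finite A] (f : A → List B) {ω : ℕ → A}
    (hω : StronglyAP ω) {β : ℕ → B} (hinf : ConcatInfinite fun n => f (ω n))
    (hβ : IsConcatOf β fun n => f (ω n)) : StronglyAP β := by
  obtain ⟨K, hK⟩ := Set.Finite.bddAbove (Set.finite_range fun a => (f a).length)
  have hK : ∀ n, (f (ω n)).length ≤ K := fun n => hK ⟨ω n, rfl⟩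
  set v : ℕ → List B := fun n => f (ω n) with hv_def
  rintro x ⟨i, hx⟩
  obtain ⟨n, hn⟩ := hinf (i + x.length)
  obtain ⟨l, hl⟩ := hω (seg ω 0 n) ⟨0, (occursAt_seg_iff ω 0 n 0).2 fun _ _ => rfl⟩
  refine ⟨K + K * l, fun p => ?_⟩
  obtain ⟨a, hpa, hap⟩ := hinf.exists_concatPos_near (v := v) hK p
  obtain ⟨j, haj, hjl, hj⟩ := hl a
  have hlen : (seg ω 0 n).length = n := by simp [seg]
  rw [hlen] at hjl
  have hv : ∀ k < n, v (j + k) = v k := fun k hk => by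
    have := (occursAt_seg_iff ω 0 n j).1 hj k hk
    rw [zero_add] at this
    simp only [hv_def, this]
  have h₁ := concatPos_mono v haj
  have h₂ := concatPos_mono v hjl
  have h₃ := concatPos_add_le (v := v) hK a l
  have h₄ := concatPos_add_of_eq v hv le_rfl
  refine ⟨concatPos v j + i, by omega, by omega, (occursAt_iff _ _ _).2 fun k hk => ?_⟩
  rw [add_assoc, hβ.eq_of_initial_eq hv (by omega)]
  exact (occursAt_iff _ _ _).1 hx k hk

/-- If `h : A* → B*` is a homomorphism of free monoids, `ω` is a strongly almost periodic
sequence over `A`, and the image `h(ω) = h(ω(0))h(ω(1))h(ω(2))…` is an infinite sequence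
`β`, then `β` is strongly almost periodic. -/
theorem homomorphism_preserves_stronglyAP {A B : Type*} [Fintype A] [Fintype B]
    (h : List A → List B) (hhom : ∀ u v : List A, h (u ++ v) = h u ++ h v)
    (ω : ℕ → A) (hω : StronglyAP ω) (β : ℕ → B)
    (hinf : ConcatInfinite (fun n => h [ω n]))
    (hβ : IsConcatOf β (fun n => h [ω n])) :
    StronglyAP β := by
  exact hω.concat (fun a => h [a]) hinf hβ
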